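/- arXiv:2605.25914 — 2 statements merged into one kernel-verified Lean document; each statement's English description precedes it below -/
import Mathlib

section
/- Let α ∈ [0,1) and let m ≥ 4 be an integer with (m−2)(m−3)/(m−1)² > α, and let μ := μ(α). Let (β_j)_{j≥1} satisfy β_j = α + ε_j where ε_j > 0, the sequence (ε_j) is strictly decreasing with ε_j → 0, and ε_j/ε_{j+1} → 1. Define ν_j := Λ(β_j, β_{j+1}, β_{j+2}, …). Then: (i) ν_j = ψ_{β_j}(ν_{j+1}) for every j ≥ 1; (ii) ν_j → μ as j → ∞; and (iii) for all sufficiently large j, ψ_{β_j}(μ) ≤ ν_{j+1}. -/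
open Filter

/-- `g_m(z) = 6·Σ_{a<b<c} z_a z_b z_c`, the Lagrangian polynomial of the complete
`3`-graph on `m` vertices. -/
noncomputable def gPoly (m : ℕ) (z : Fin m → ℝ) : ℝ :=
  6 * ∑ e ∈ Finset.powersetCard 3 (Finset.univ : Finset (Fin m)), ∏ i ∈ e, z i

/-- `ψ_b(t) = max_{z∈Δ_{m−1}} ( g_m(z) + t·z₁³ + b·z₂³ )`. -/
noncomputable def psi (m : ℕ) (hm : 3 ≤ m) (b t : ℝ) : ℝ :=
  sSup { v : ℝ | ∃ z ∈ stdSimplex ℝ (Fin m),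
    v = gPoly m z + t * z ⟨0, by omega⟩ ^ 3 + b * z ⟨1, by omega⟩ ^ 3 }

/-- `μ(a) = max { (g_m(z) + a·z₂³)/(1 − z₁³) : z ∈ Δ_{m−1}, z₁ < 1 }`. -/
noncomputable def muFun (m : ℕ) (hm : 3 ≤ m) (a : ℝ) : ℝ :=
  sSup { v : ℝ | ∃ z ∈ stdSimplex ℝ (Fin m), z ⟨0, by omega⟩ < 1 ∧
    v = (gPoly m z + a * z ⟨1, by omega⟩ ^ 3) / (1 - z ⟨0, by omega⟩ ^ 3) }

/-- The set `X` of maximizers in the definition of `μ(a)`. -/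
def Xset (m : ℕ) (hm : 3 ≤ m) (a : ℝ) : Set (Fin m → ℝ) :=
  { z | z ∈ stdSimplex ℝ (Fin m) ∧ z ⟨0, by omega⟩ < 1 ∧
    (gPoly m z + a * z ⟨1, by omega⟩ ^ 3) / (1 - z ⟨0, by omega⟩ ^ 3) = muFun m hm a }

/-- The `s`-level truncated recursive value:
`Λ_s(b) = ψ_{b₀}(ψ_{b₁}(⋯ψ_{b_{s−1}}(0)⋯))`. -/
noncomputable def LambdaTrunc (m : ℕ) (hm : 3 ≤ m) : ℕ → (ℕ → ℝ) → ℝ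
  | 0, _ => 0
  | s + 1, b => psi m hm (b 0) (LambdaTrunc m hm s (fun i => b (i + 1)))

section ElementarySymmetric

variable {ι : Type*}

/-- The `k`-th elementary symmetric sum of the values of `z` on `s`. -/
noncomputable def elemSum (k : ℕ) (s : Finset ι) (z : ι → ℝ) : ℝ :=
  ∑ e ∈ Finset.powersetCard k s, ∏ i ∈ e, z i

theorem elemSum_insert [DecidableEq ι] {a : ι} {s : Finset ι} (ha : a ∉ s) (k : ℕ) (z : ι → ℝ) :
    elemSum (k + 1) (insert a s) z = elemSum (k + 1) s z + z a * elemSum k s z := by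
  have hmem : ∀ e ∈ Finset.powersetCard k s, a ∉ e := fun e he h =>
    ha ((Finset.mem_powersetCard.1 he).1 h)
  unfold elemSum
  rw [Finset.powersetCard_succ_insert ha, Finset.sum_union, Finset.sum_image, Finset.mul_sum]
  · congr 1
    exact Finset.sum_congr rfl fun e he => Finset.prod_insert (hmem e he)
  · intro e he f hf h
    rw [← Finset.erase_insert (hmem e he), ← Finset.erase_insert (hmem f hf)]
    exact congrArg (fun t => Finset.erase t a) h
  · rw [Finset.disjoint_left]
    intro e he h
    obtain ⟨f, -, rfl⟩ := Finset.mem_image.1 h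
    exact ha ((Finset.mem_powersetCard.1 he).1 (Finset.mem_insert_self a f))

theorem elemSum_succ_empty (k : ℕ) (z : ι → ℝ) : elemSum (k + 1) ∅ z = 0 := by
  rw [elemSum, Finset.powersetCard_eq_empty.2 (by simp), Finset.sum_empty]

theorem elemSum_one (s : Finset ι) (z : ι → ℝ) : elemSum 1 s z = ∑ i ∈ s, z i := by
  simp [elemSum, Finset.powersetCard_one]

theorem elemSum_congr {k : ℕ} {s : Finset ι} {z w : ι → ℝ} (h : ∀ i ∈ s, z i = w i) :
    elemSum k s z = elemSum k s w :=
  Finset.sum_congr rfl fun _ he => Finset.prod_congr rfl fun i hi =>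
    h i ((Finset.mem_powersetCard.1 he).1 hi)

theorem elemSum_nonneg (k : ℕ) (s : Finset ι) {z : ι → ℝ} (hz : ∀ i, 0 ≤ z i) :
    0 ≤ elemSum k s z :=
  Finset.sum_nonneg fun _ _ => Finset.prod_nonneg fun i _ => hz i

theorem elemSum_smul (k : ℕ) (s : Finset ι) (c : ℝ) (z : ι → ℝ) :
    elemSum k s (fun i => c * z i) = c ^ k * elemSum k s z := by
  unfold elemSum
  rw [Finset.mul_sum]
  refine Finset.sum_congr rfl fun e he => ?_
  rw [Finset.prod_mul_distrib, Finset.prod_const, (Finset.mem_powersetCard.1 he).2]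

theorem elemSum_two_le [DecidableEq ι] (s : Finset ι) (z : ι → ℝ) :
    2 * elemSum 2 s z ≤ (∑ i ∈ s, z i) ^ 2 := by
  induction s using Finset.induction_on with
  | empty => simp [elemSum_succ_empty]
  | insert a s ha ih =>
    rw [elemSum_insert ha 1, elemSum_one, Finset.sum_insert ha]
    nlinarith [sq_nonneg (z a)]

theorem elemSum_three_le [DecidableEq ι] (s : Finset ι) {z : ι → ℝ} (hz : ∀ i, 0 ≤ z i) :
    6 * elemSum 3 s z ≤ (∑ i ∈ s, z i) ^ 3 := by
  induction s using Finset.induction_on with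
  | empty => simp [elemSum_succ_empty]
  | insert a s ha ih =>
    rw [elemSum_insert ha 2, Finset.sum_insert ha]
    have hS : 0 ≤ ∑ i ∈ s, z i := Finset.sum_nonneg fun i _ => hz i
    have h2 := mul_le_mul_of_nonneg_left (elemSum_two_le s z) (hz a)
    nlinarith [pow_nonneg (hz a) 3, mul_nonneg (pow_nonneg (hz a) 2) hS]

theorem continuous_elemSum (k : ℕ) (s : Finset ι) : Continuous (elemSum k s) := by
  unfold elemSum
  fun_prop

end ElementarySymmetric

section Lagrangian

variable {m : ℕ}

theorem gPoly_eq_elemSum (z : Fin m → ℝ) : gPoly m z = 6 * elemSum 3 Finset.univ z := rfl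

theorem gPoly_smul (c : ℝ) (z : Fin m → ℝ) :
    gPoly m (fun i => c * z i) = c ^ 3 * gPoly m z := by
  rw [gPoly_eq_elemSum, elemSum_smul, gPoly_eq_elemSum]
  ring

theorem continuous_gPoly : Continuous (gPoly m) :=
  continuous_const.mul (continuous_elemSum 3 _)

theorem gPoly_comp_perm (σ : Equiv.Perm (Fin m)) (z : Fin m → ℝ) :
    gPoly m (z ∘ σ) = gPoly m z := by
  have h : ∀ w : Fin m → ℝ, gPoly m w = 6 * ((Finset.univ.val.map w).esymm 3) := fun w => by
    rw [Finset.esymm_map_val]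
    rfl
  rw [h, h, ← Multiset.map_map, Multiset.map_univ_val_equiv]

theorem gPoly_nonneg {z : Fin m → ℝ} (hz : ∀ i, 0 ≤ z i) : 0 ≤ gPoly m z :=
  mul_nonneg (by norm_num) (elemSum_nonneg 3 _ hz)

/-- The indices other than `p` and `q`. -/
def othersOf (p q : Fin m) : Finset (Fin m) := (Finset.univ.erase p).erase q

theorem mem_othersOf {p q i : Fin m} : i ∈ othersOf p q ↔ i ≠ q ∧ i ≠ p := by
  simp [othersOf]

theorem univ_eq_insert_othersOf (p q : Fin m) :
    (Finset.univ : Finset (Fin m)) = insert p (insert q (othersOf p q)) := by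
  ext i
  simp only [Finset.mem_univ, Finset.mem_insert, mem_othersOf, true_iff]
  tauto

theorem sum_eq_add_othersOf {p q : Fin m} (hpq : p ≠ q) (z : Fin m → ℝ) :
    ∑ i, z i = z p + z q + ∑ i ∈ othersOf p q, z i := by
  rw [univ_eq_insert_othersOf p q, Finset.sum_insert, Finset.sum_insert]
  · ring
  · simp [mem_othersOf]
  · simp [mem_othersOf, hpq]

theorem gPoly_eq_othersOf {p q : Fin m} (hpq : p ≠ q) (z : Fin m → ℝ) :
    gPoly m z = 6 * (elemSum 3 (othersOf p q) z + (z p + z q) * elemSum 2 (othersOf p q) z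
      + z p * z q * ∑ i ∈ othersOf p q, z i) := by
  have hq : q ∉ othersOf p q := by simp [mem_othersOf]
  have hp : p ∉ insert q (othersOf p q) := by simp [mem_othersOf, hpq]
  rw [gPoly_eq_elemSum, univ_eq_insert_othersOf p q, elemSum_insert hp 2, elemSum_insert hq 2,
    elemSum_insert hq 1, elemSum_one]
  ring

theorem gPoly_add_cubes_le {p q : Fin m} (hpq : p ≠ q) {z : Fin m → ℝ}
    (hz : z ∈ stdSimplex ℝ (Fin m)) : gPoly m z + z p ^ 3 + z q ^ 3 ≤ 1 := by
  obtain ⟨h0, h1⟩ := hz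
  rw [sum_eq_add_othersOf hpq] at h1
  rw [gPoly_eq_othersOf hpq]
  have h3 := elemSum_three_le (othersOf p q) h0
  have h2 := elemSum_two_le (othersOf p q) z
  have hS : 0 ≤ ∑ i ∈ othersOf p q, z i := Finset.sum_nonneg fun i _ => h0 i
  have hp := h0 p
  have hq := h0 q
  generalize z p = a at *
  generalize z q = b at *
  generalize ∑ i ∈ othersOf p q, z i = S at *
  generalize elemSum 3 (othersOf p q) z = A at *
  generalize elemSum 2 (othersOf p q) z = B at *
  have hone : (a + b + S) ^ 3 = 1 := by rw [h1]; norm_num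
  have h4 := mul_le_mul_of_nonneg_left h2 (add_nonneg hp hq)
  have h5 : 0 ≤ (a + b) * (a * b) + S * (a + b) ^ 2 := by positivity
  have h6 : 0 ≤ S * (a ^ 2 + b ^ 2) := by positivity
  have h7 : 0 ≤ (a + b) * (a * b) := by positivity
  nlinarith

theorem gPoly_le_sq {p q : Fin m} (hpq : p ≠ q) {z : Fin m → ℝ}
    (hz : z ∈ stdSimplex ℝ (Fin m)) : gPoly m z ≤ 3 * (1 - z p) ^ 2 := by
  obtain ⟨h0, h1⟩ := hz
  rw [sum_eq_add_othersOf hpq] at h1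
  rw [gPoly_eq_othersOf hpq]
  have h3 := elemSum_three_le (othersOf p q) h0
  have h2 := elemSum_two_le (othersOf p q) z
  have hS : 0 ≤ ∑ i ∈ othersOf p q, z i := Finset.sum_nonneg fun i _ => h0 i
  have hp := h0 p
  have hq := h0 q
  generalize z p = a at *
  generalize z q = b at *
  generalize ∑ i ∈ othersOf p q, z i = S at *
  generalize elemSum 3 (othersOf p q) z = A at *
  generalize elemSum 2 (othersOf p q) z = B at *
  have ha : 1 - a = b + S := by linarith
  rw [ha]
  have h4 := mul_le_mul_of_nonneg_left h2 (add_nonneg hp hq)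
  have h5 : 0 ≤ 3 * a * b ^ 2 + b ^ 3 + 3 * b ^ 2 * S := by positivity
  have h6 : 6 * (A + (a + b) * B + a * b * S) ≤ 3 * a * (b + S) ^ 2 + (b + S) ^ 3 := by
    nlinarith
  have h7 : 3 * a * (b + S) ^ 2 + (b + S) ^ 3 = (3 * a + (b + S)) * (b + S) ^ 2 := by ring
  rw [h7] at h6
  have h8 : (3 * a + (b + S)) * (b + S) ^ 2 ≤ 3 * (b + S) ^ 2 :=
    mul_le_mul_of_nonneg_right (by linarith) (sq_nonneg _)
  exact h6.trans h8

end Lagrangian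

theorem not_maximizer_of_first_eq_zero {M a A B S x : ℝ} (ha : 0 ≤ a) (ha1 : a ≤ 1) (haM : a < M)
    (hA : 0 ≤ A) (hS : 0 ≤ S) (hx : 0 < x) (hxS : x + S = 1)
    (heq : 6 * (A + x * B) + a * x ^ 3 = M)
    (hle : ∀ p q : ℝ, 0 ≤ p → 0 ≤ q → 0 < p + q + S →
      6 * (A + (p + q) * B + p * q * S) + a * q ^ 3 ≤ M * ((p + q + S) ^ 3 - p ^ 3)) : False := by
  have hM : 0 < M := ha.trans_lt haM
  have hfirst : 6 * (B + x * S) ≤ 3 * M := by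
    refine le_of_forall_pos_le_add fun s hs => ?_
    have hs' : 0 < s / (3 * M) := by positivity
    have h := hle (s / (3 * M)) x hs'.le hx.le (by linarith)
    set t := s / (3 * M) with ht
    have hst : s = 3 * M * t := by rw [ht]; field_simp
    rw [show t + x + S = 1 + t by linarith] at h
    have h' : t * (6 * (B + x * S)) ≤ t * (3 * M + s) := by
      rw [hst]
      nlinarith
    exact le_of_mul_le_mul_left h' hs'
  have hsecond : 3 * M ≤ 6 * B + 3 * a * x ^ 2 := by
    refine le_of_forall_pos_le_add fun s hs => ?_
    obtain ⟨h, hh, hhx, hhs⟩ : ∃ h : ℝ, 0 < h ∧ h < x ∧ 4 * M * h ≤ s := by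
      refine ⟨min (x / 2) (s / (4 * M)), by positivity,
        (min_le_left _ _).trans_lt (by linarith), ?_⟩
      calc 4 * M * min (x / 2) (s / (4 * M)) ≤ 4 * M * (s / (4 * M)) :=
            mul_le_mul_of_nonneg_left (min_le_right _ _) (by positivity)
        _ = s := by field_simp
    have h1 := hle 0 (x - h) le_rfl (by linarith) (by linarith)
    rw [show 0 + (x - h) + S = 1 - h by linarith] at h1
    have h2 : h * (M * (3 - 3 * h + h ^ 2)) ≤
        h * (6 * B + a * (3 * x ^ 2 - 3 * x * h + h ^ 2)) := by
      nlinarith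
    have h3 := le_of_mul_le_mul_left h2 hh
    have hx1 : x ≤ 1 := by linarith
    have h4 : a * (h ^ 2 - 3 * x * h) ≤ 0 :=
      mul_nonpos_of_nonneg_of_nonpos ha (by nlinarith)
    have h5 : 0 ≤ M * h ^ 2 := by positivity
    nlinarith [mul_pos hM hh]
  have hx1 : x ≤ 1 := by linarith
  have hS' : S = 1 - x := by linarith
  subst hS'
  have h23 : 2 / 3 ≤ x := by
    have h : x * (6 * (1 - x)) ≤ x * (3 * a * x) := by nlinarith
    have h' := le_of_mul_le_mul_left h hx
    nlinarith [mul_le_mul_of_nonneg_right ha1 hx.le]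
  have h4 : M * (3 * x - 1) ≤ 2 * a * x ^ 3 := by
    nlinarith [mul_le_mul_of_nonneg_left hsecond hx.le]
  have h5 : 2 * x ^ 3 ≤ 3 * x - 1 := by
    nlinarith [mul_nonneg (sub_nonneg.2 hx1) (show (0 : ℝ) ≤ 2 * x ^ 2 + 2 * x - 1 by nlinarith)]
  nlinarith [mul_le_mul_of_nonneg_left h5 ha,
    mul_pos (sub_pos.2 haM) (show 0 < 3 * x - 1 by linarith)]

section Psi

variable {m : ℕ} {hm : 3 ≤ m}

theorem first_ne_second : (⟨0, by omega⟩ : Fin m) ≠ ⟨1, by omega⟩ := by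
  simp

theorem pow_three_le_one {z : Fin m → ℝ} (hz : z ∈ stdSimplex ℝ (Fin m)) (i : Fin m) :
    z i ^ 3 ≤ 1 :=
  pow_le_one₀ (hz.1 i) (stdSimplex.le_one ⟨z, hz⟩ i)

theorem le_psi (b t : ℝ) {z : Fin m → ℝ} (hz : z ∈ stdSimplex ℝ (Fin m)) :
    gPoly m z + t * z ⟨0, by omega⟩ ^ 3 + b * z ⟨1, by omega⟩ ^ 3 ≤ psi m hm b t := by
  refine le_csSup ?_ ⟨z, hz, rfl⟩
  refine ⟨1 + |t| + |b|, ?_⟩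
  rintro _ ⟨w, hw, rfl⟩
  have hcube : ∀ (c : ℝ) (i : Fin m), c * w i ^ 3 ≤ |c| := fun c i =>
    calc c * w i ^ 3 ≤ |c| * w i ^ 3 :=
          mul_le_mul_of_nonneg_right (le_abs_self c) (pow_nonneg (hw.1 i) 3)
      _ ≤ |c| := mul_le_of_le_one_right (abs_nonneg c) (pow_three_le_one hw i)
  have h0 : (⟨0, by omega⟩ : Fin m) ≠ ⟨1, by omega⟩ := first_ne_second (hm := hm)
  have hg := gPoly_add_cubes_le h0 hw
  have := pow_nonneg (hw.1 ⟨0, by omega⟩) 3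
  have := pow_nonneg (hw.1 ⟨1, by omega⟩) 3
  linarith [hcube t ⟨0, by omega⟩, hcube b ⟨1, by omega⟩]

theorem psi_le {b t v : ℝ} (h : ∀ z ∈ stdSimplex ℝ (Fin m),
    gPoly m z + t * z ⟨0, by omega⟩ ^ 3 + b * z ⟨1, by omega⟩ ^ 3 ≤ v) : psi m hm b t ≤ v := by
  refine csSup_le ⟨_, Pi.single ⟨0, by omega⟩ 1, single_mem_stdSimplex ℝ _, rfl⟩ ?_
  rintro _ ⟨z, hz, rfl⟩
  exact h z hz

theorem psi_mono {b b' t t' : ℝ} (hb : b ≤ b') (ht : t ≤ t') : psi m hm b t ≤ psi m hm b' t' := by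
  refine psi_le fun z hz => le_trans ?_ (le_psi b' t' hz)
  have h0 := mul_le_mul_of_nonneg_right ht (pow_nonneg (hz.1 ⟨0, by omega⟩) 3)
  have h1 := mul_le_mul_of_nonneg_right hb (pow_nonneg (hz.1 ⟨1, by omega⟩) 3)
  linarith

theorem lipschitzWith_psi (b : ℝ) : LipschitzWith 1 (psi m hm b) := by
  refine LipschitzWith.of_le_add fun t t' => psi_le fun z hz => ?_
  have h1 : (t - t') * z ⟨0, by omega⟩ ^ 3 ≤ dist t t' :=
    calc (t - t') * z ⟨0, by omega⟩ ^ 3 ≤ |t - t'| * z ⟨0, by omega⟩ ^ 3 :=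
          mul_le_mul_of_nonneg_right (le_abs_self _) (pow_nonneg (hz.1 _) 3)
      _ ≤ |t - t'| := mul_le_of_le_one_right (abs_nonneg _) (pow_three_le_one hz _)
  linarith [le_psi (hm := hm) b t' hz]

theorem psi_nonneg {b t : ℝ} (hb : 0 ≤ b) (ht : 0 ≤ t) : 0 ≤ psi m hm b t := by
  have hz := single_mem_stdSimplex ℝ (⟨0, by omega⟩ : Fin m)
  refine le_trans ?_ (le_psi b t hz)
  have := gPoly_nonneg hz.1
  have := mul_nonneg ht (pow_nonneg (hz.1 ⟨0, by omega⟩) 3)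
  have := mul_nonneg hb (pow_nonneg (hz.1 ⟨1, by omega⟩) 3)
  linarith

theorem LambdaTrunc_nonneg (s : ℕ) {b : ℕ → ℝ} (hb : ∀ i, 0 ≤ b i) :
    0 ≤ LambdaTrunc m hm s b := by
  induction s generalizing b with
  | zero => exact le_rfl
  | succ s ih => exact psi_nonneg (hb 0) (ih fun i => hb (i + 1))

theorem LambdaTrunc_le {B M : ℝ} (hM : 0 ≤ M) (hfix : psi m hm B M ≤ M) (s : ℕ) {b : ℕ → ℝ}
    (hb : ∀ i, b i ≤ B) : LambdaTrunc m hm s b ≤ M := by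
  induction s generalizing b with
  | zero => exact hM
  | succ s ih => exact (psi_mono (hb 0) (ih fun i => hb (i + 1))).trans hfix

end Psi

section Mu

variable {m : ℕ} {hm : 3 ≤ m}

theorem gPoly_add_le_one_sub {a : ℝ} (ha : a ≤ 1) {z : Fin m → ℝ}
    (hz : z ∈ stdSimplex ℝ (Fin m)) :
    gPoly m z + a * z ⟨1, by omega⟩ ^ 3 ≤ 1 - z ⟨0, by omega⟩ ^ 3 := by
  have h := gPoly_add_cubes_le (first_ne_second (hm := hm)) hz
  linarith [mul_le_mul_of_nonneg_right ha (pow_nonneg (hz.1 ⟨1, by omega⟩) 3)]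

theorem one_sub_pow_three_pos {z : Fin m → ℝ} (hz : z ∈ stdSimplex ℝ (Fin m)) {i : Fin m}
    (hi : z i < 1) : 0 < 1 - z i ^ 3 :=
  sub_pos.2 (pow_lt_one₀ (hz.1 i) hi (by norm_num))

theorem div_le_muFun {a : ℝ} (ha : a ≤ 1) {z : Fin m → ℝ} (hz : z ∈ stdSimplex ℝ (Fin m))
    (hz0 : z ⟨0, by omega⟩ < 1) :
    (gPoly m z + a * z ⟨1, by omega⟩ ^ 3) / (1 - z ⟨0, by omega⟩ ^ 3) ≤ muFun m hm a := by
  refine le_csSup ⟨1, ?_⟩ ⟨z, hz, hz0, rfl⟩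
  rintro _ ⟨w, hw, hw0, rfl⟩
  rw [div_le_one (one_sub_pow_three_pos hw hw0)]
  exact gPoly_add_le_one_sub (hm := hm) ha hw

theorem gPoly_add_le_muFun_mul {a : ℝ} (ha : a ≤ 1) {z : Fin m → ℝ}
    (hz : z ∈ stdSimplex ℝ (Fin m)) :
    gPoly m z + a * z ⟨1, by omega⟩ ^ 3 ≤ muFun m hm a * (1 - z ⟨0, by omega⟩ ^ 3) := by
  rcases (stdSimplex.le_one ⟨z, hz⟩ (⟨0, by omega⟩ : Fin m)).lt_or_eq with h | h
  · exact (div_le_iff₀ (one_sub_pow_three_pos hz h)).1 (div_le_muFun ha hz h)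
  · replace h : z ⟨0, by omega⟩ = 1 := h
    have := gPoly_add_le_one_sub (hm := hm) ha hz
    rw [h] at this ⊢
    linarith

theorem muFun_le {a t : ℝ} (h : ∀ z ∈ stdSimplex ℝ (Fin m), z ⟨0, by omega⟩ < 1 →
    gPoly m z + a * z ⟨1, by omega⟩ ^ 3 ≤ t * (1 - z ⟨0, by omega⟩ ^ 3)) :
    muFun m hm a ≤ t := by
  refine csSup_le ⟨_, Pi.single ⟨1, by omega⟩ 1, single_mem_stdSimplex ℝ _, ?_, rfl⟩ ?_
  · rw [Pi.single_eq_of_ne (first_ne_second (hm := hm))]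
    norm_num
  · rintro _ ⟨z, hz, hz0, rfl⟩
    exact (div_le_iff₀ (one_sub_pow_three_pos hz hz0)).2 (h z hz hz0)

theorem muFun_le_of_psi_le {a t : ℝ} (h : psi m hm a t ≤ t) : muFun m hm a ≤ t :=
  muFun_le fun z hz _ => by linarith [le_psi (hm := hm) a t hz]

theorem psi_muFun_le {a : ℝ} (ha : a ≤ 1) : psi m hm a (muFun m hm a) ≤ muFun m hm a :=
  psi_le fun z hz => by linarith [gPoly_add_le_muFun_mul (hm := hm) ha hz]

theorem muFun_le_add {a b : ℝ} (ha : a ≤ 1) (hab : a ≤ b) :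
    muFun m hm b ≤ muFun m hm a + (b - a) :=
  muFun_le fun z hz _ => by
    have h1 := gPoly_add_le_muFun_mul (hm := hm) ha hz
    have h2 := gPoly_add_cubes_le (first_ne_second (hm := hm)) hz
    have h3 : (b - a) * z ⟨1, by omega⟩ ^ 3 ≤ (b - a) * (1 - z ⟨0, by omega⟩ ^ 3) :=
      mul_le_mul_of_nonneg_left (by linarith [gPoly_nonneg hz.1]) (by linarith)
    linarith

theorem le_muFun (hm4 : 4 ≤ m) {a : ℝ} (ha0 : 0 ≤ a) (ha : a ≤ 1) :
    ((m : ℝ) - 2) * ((m : ℝ) - 3) / ((m : ℝ) - 1) ^ 2 ≤ muFun m hm a := by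
  have hm' : (4 : ℝ) ≤ m := by exact_mod_cast hm4
  have hmpos : (0 : ℝ) < m := by linarith
  have hz : (fun _ => (m : ℝ)⁻¹) ∈ stdSimplex ℝ (Fin m) := by
    refine ⟨fun _ => by positivity, ?_⟩
    simp [hmpos.ne']
  have h := gPoly_add_le_muFun_mul (hm := hm) ha hz
  have hchoose : 6 * (m.choose 3 : ℝ) = m * (m - 1) * (m - 2) := by
    have h3 : (m.descFactorial 3 : ℝ) = 6 * m.choose 3 := by
      rw [Nat.descFactorial_eq_factorial_mul_choose]
      norm_num [Nat.factorial]
    rw [← h3]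
    simp only [Nat.descFactorial, Nat.cast_mul, Nat.cast_sub (show 2 ≤ m by omega),
      Nat.cast_sub (show 1 ≤ m by omega), Nat.sub_zero, Nat.cast_one, Nat.cast_ofNat]
    ring
  have hg : gPoly m (fun _ => (m : ℝ)⁻¹) = (m - 1) * (m - 2) / m ^ 2 := by
    have : gPoly m (fun _ => (m : ℝ)⁻¹) = 6 * (m.choose 3 : ℝ) * (m : ℝ)⁻¹ ^ 3 := by
      rw [gPoly, Finset.sum_congr rfl (g := fun _ => (m : ℝ)⁻¹ ^ 3)]
      · simp [mul_assoc]
      · intro e he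
        rw [Finset.prod_const, (Finset.mem_powersetCard.1 he).2]
    rw [this, hchoose]
    field_simp
  rw [hg] at h
  have hapos : 0 ≤ a * (m : ℝ)⁻¹ ^ 3 := by positivity
  have hpos : (0 : ℝ) < 1 - (m : ℝ)⁻¹ ^ 3 :=
    sub_pos.2 (pow_lt_one₀ (by positivity) (inv_lt_one_of_one_lt₀ (by linarith)) (by norm_num))
  refine le_of_mul_le_mul_right (le_trans ?_ (le_trans (le_add_of_nonneg_right hapos) h)) hpos
  rw [div_mul_eq_mul_div, div_le_div_iff₀ (by nlinarith) (by positivity)]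
  have hexp : (1 - (m : ℝ)⁻¹ ^ 3) * m ^ 2 = (m - 1) * (m ^ 2 + m + 1) / m := by
    field_simp
    ring
  rw [mul_assoc, hexp, mul_div_assoc', div_le_iff₀ hmpos]
  nlinarith [mul_nonneg (mul_nonneg (show (0 : ℝ) ≤ m - 1 by linarith)
    (show (0 : ℝ) ≤ m - 2 by linarith)) (show (0 : ℝ) ≤ 3 * m + 3 by linarith)]

end Mu

/-- The gap `μ(a)(1 − z₁³) − g_m(z) − a·z₂³`, which is nonnegative on the simplex. -/
noncomputable def defect (m : ℕ) (hm : 3 ≤ m) (a : ℝ) (z : Fin m → ℝ) : ℝ :=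
  muFun m hm a * (1 - z ⟨0, by omega⟩ ^ 3) - gPoly m z - a * z ⟨1, by omega⟩ ^ 3

section Maximizers

variable {m : ℕ} {hm : 3 ≤ m}

theorem Xset_nonempty {a : ℝ} (ha : a ≤ 1) (hpos : 0 < muFun m hm a) :
    (Xset m hm a).Nonempty := by
  set M := muFun m hm a with hM
  set F : (Fin m → ℝ) → ℝ := fun z =>
    (gPoly m z + a * z ⟨1, by omega⟩ ^ 3) / (1 - z ⟨0, by omega⟩ ^ 3) with hF
  set K : Set (Fin m → ℝ) := stdSimplex ℝ (Fin m) ∩ {z | z ⟨0, by omega⟩ ≤ 1 - M / 8} with hK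
  have hK1 : ∀ z ∈ K, z ⟨0, by omega⟩ < 1 := fun z hz => by
    have : z ⟨0, by omega⟩ ≤ 1 - M / 8 := hz.2
    linarith
  have hcompact : IsCompact K :=
    (isCompact_stdSimplex ℝ (Fin m)).inter_right
      (isClosed_le (continuous_apply _) continuous_const)
  have hcont : ContinuousOn F K := by
    refine ContinuousOn.div (by have := continuous_gPoly (m := m); fun_prop) (by fun_prop)
      fun z hz => (one_sub_pow_three_pos hz.1 (hK1 z hz)).ne'
  have hfar : ∀ z ∈ stdSimplex ℝ (Fin m), z ⟨0, by omega⟩ < 1 → z ∉ K →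
      gPoly m z + a * z ⟨1, by omega⟩ ^ 3 ≤ M / 2 * (1 - z ⟨0, by omega⟩ ^ 3) := by
    intro z hz hz1 hzK
    have hnear : 1 - M / 8 < z ⟨0, by omega⟩ := not_le.1 fun h => hzK ⟨hz, h⟩
    have hne := first_ne_second (hm := hm)
    have hg := gPoly_le_sq hne hz
    have hsum := hz.2
    rw [sum_eq_add_othersOf hne] at hsum
    have hS := Finset.sum_nonneg fun k
      (_ : k ∈ othersOf (⟨0, by omega⟩ : Fin m) ⟨1, by omega⟩) => hz.1 k
    have h1 := hz.1 ⟨1, by omega⟩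
    have h0 := hz.1 ⟨0, by omega⟩
    have hq : z ⟨1, by omega⟩ ≤ 1 - z ⟨0, by omega⟩ := by linarith
    have hq3 := pow_le_pow_left₀ h1 hq 3
    have haq := mul_le_mul_of_nonneg_right ha (pow_nonneg h1 3)
    have hcube : z ⟨0, by omega⟩ ^ 3 ≤ z ⟨0, by omega⟩ :=
      pow_le_of_le_one h0 hz1.le (by norm_num)
    have hη : 0 < 1 - z ⟨0, by omega⟩ := sub_pos.2 hz1
    have hη1 : 1 - z ⟨0, by omega⟩ ≤ 1 := by linarith
    generalize z ⟨0, by omega⟩ = p at *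
    generalize z ⟨1, by omega⟩ = q at *
    have h4 : (1 - p) ^ 3 ≤ (1 - p) ^ 2 := pow_le_pow_of_le_one hη.le hη1 (by norm_num)
    have h5 : 4 * (1 - p) ^ 2 ≤ M / 2 * (1 - p) := by nlinarith
    have h6 : M / 2 * (1 - p) ≤ M / 2 * (1 - p ^ 3) :=
      mul_le_mul_of_nonneg_left (by linarith) (by linarith)
    linarith
  have hKne : K.Nonempty := by
    by_contra hcon
    have : M ≤ M / 2 := muFun_le fun z hz hz1 => hfar z hz hz1 fun h => hcon ⟨z, h⟩
    linarith
  obtain ⟨w, hwK, hw⟩ := hcompact.exists_isMaxOn hKne hcont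
  refine ⟨w, hwK.1, hK1 w hwK, le_antisymm (div_le_muFun ha hwK.1 (hK1 w hwK)) ?_⟩
  have hmax : M ≤ max (F w) (M / 2) := by
    refine muFun_le fun z hz hz1 => ?_
    have hz3 := one_sub_pow_three_pos hz hz1
    by_cases hzK : z ∈ K
    · exact (div_le_iff₀ hz3).1 ((hw hzK).trans (le_max_left _ _))
    · exact (hfar z hz hz1 hzK).trans (mul_le_mul_of_nonneg_right (le_max_right _ _) hz3.le)
  rcases le_max_iff.1 hmax with h | h
  · exact h
  · linarith

theorem continuous_defect (a : ℝ) : Continuous (defect m hm a) := by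
  have := continuous_gPoly (m := m)
  unfold defect
  fun_prop

theorem defect_nonneg {a : ℝ} (ha : a ≤ 1) {z : Fin m → ℝ} (hz : z ∈ stdSimplex ℝ (Fin m)) :
    0 ≤ defect m hm a z := by
  unfold defect
  linarith [gPoly_add_le_muFun_mul (hm := hm) ha hz]

theorem exists_defect_eq_zero {a : ℝ} (ha0 : 0 ≤ a) (ha : a ≤ 1) (hpos : 0 < muFun m hm a) :
    ∃ z ∈ stdSimplex ℝ (Fin m), defect m hm a z = 0 ∧ 0 < z ⟨1, by omega⟩ := by
  obtain ⟨z, hz, hz1, hzM⟩ := Xset_nonempty ha hpos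
  have hD : defect m hm a z = 0 := by
    rw [div_eq_iff (one_sub_pow_three_pos hz hz1).ne'] at hzM
    unfold defect
    linarith
  rcases (hz.1 ⟨1, by omega⟩).lt_or_eq with h | h
  · exact ⟨z, hz, hD, h⟩
  have hne := first_ne_second (hm := hm)
  obtain ⟨k, hk, hzk⟩ : ∃ k ∈ othersOf (⟨0, by omega⟩ : Fin m) ⟨1, by omega⟩, 0 < z k := by
    by_contra! hcon
    have hsum := hz.2
    rw [sum_eq_add_othersOf hne, ← h] at hsum
    linarith [Finset.sum_nonpos hcon]
  obtain ⟨hk1, hk0⟩ := mem_othersOf.1 hk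
  set σ : Equiv.Perm (Fin m) := Equiv.swap ⟨1, by omega⟩ k with hσ
  have hw : z ∘ σ ∈ stdSimplex ℝ (Fin m) :=
    ⟨fun i => hz.1 _, (Equiv.sum_comp σ z).trans hz.2⟩
  have hw1 : (z ∘ σ) ⟨1, by omega⟩ = z k := by simp [hσ]
  have hw0 : (z ∘ σ) ⟨0, by omega⟩ = z ⟨0, by omega⟩ := by
    simp only [hσ, Function.comp_apply]
    rw [Equiv.swap_apply_of_ne_of_ne hne (Ne.symm hk0)]
  refine ⟨z ∘ σ, hw, le_antisymm ?_ (defect_nonneg ha hw), hw1 ▸ hzk⟩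
  have hcube := mul_nonneg ha0 (pow_nonneg hzk.le 3)
  unfold defect at hD ⊢
  rw [hw0, hw1, gPoly_comp_perm]
  rw [← h] at hD
  linarith

theorem gPoly_add_le_of_nonneg {a : ℝ} (ha : a ≤ 1) {z : Fin m → ℝ} (hz : ∀ i, 0 ≤ z i)
    (hsum : 0 < ∑ i, z i) :
    gPoly m z + a * z ⟨1, by omega⟩ ^ 3 ≤
      muFun m hm a * ((∑ i, z i) ^ 3 - z ⟨0, by omega⟩ ^ 3) := by
  set s := ∑ i, z i with hs
  have hw : (fun i => s⁻¹ * z i) ∈ stdSimplex ℝ (Fin m) := by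
    refine ⟨fun i => mul_nonneg (inv_nonneg.2 hsum.le) (hz i), ?_⟩
    rw [← Finset.mul_sum, inv_mul_cancel₀ hsum.ne']
  have h := gPoly_add_le_muFun_mul (hm := hm) ha hw
  rw [gPoly_smul] at h
  have h' := mul_le_mul_of_nonneg_left h (pow_nonneg hsum.le 3)
  have hs3 : s ^ 3 * s⁻¹ ^ 3 = 1 := by rw [← mul_pow, mul_inv_cancel₀ hsum.ne', one_pow]
  calc gPoly m z + a * z ⟨1, by omega⟩ ^ 3
      = (s ^ 3 * s⁻¹ ^ 3) * (gPoly m z + a * z ⟨1, by omega⟩ ^ 3) := by rw [hs3, one_mul]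
    _ = s ^ 3 * (s⁻¹ ^ 3 * gPoly m z + a * (s⁻¹ * z ⟨1, by omega⟩) ^ 3) := by ring
    _ ≤ _ := h'
    _ = muFun m hm a * (s ^ 3 - (s ^ 3 * s⁻¹ ^ 3) * z ⟨0, by omega⟩ ^ 3) := by ring
    _ = _ := by rw [hs3, one_mul]

theorem first_pos_of_defect_eq_zero {a : ℝ} (ha0 : 0 ≤ a) (ha : a ≤ 1) (hmu : a < muFun m hm a)
    {z : Fin m → ℝ} (hz : z ∈ stdSimplex ℝ (Fin m)) (hD : defect m hm a z = 0)
    (hz1 : 0 < z ⟨1, by omega⟩) : 0 < z ⟨0, by omega⟩ := by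
  by_contra hcon
  have hz0 : z ⟨0, by omega⟩ = 0 := le_antisymm (not_lt.1 hcon) (hz.1 _)
  have hne := first_ne_second (hm := hm)
  set R := othersOf (⟨0, by omega⟩ : Fin m) ⟨1, by omega⟩ with hR
  have hsum := hz.2
  rw [sum_eq_add_othersOf hne, hz0, zero_add] at hsum
  refine not_maximizer_of_first_eq_zero ha0 ha hmu (elemSum_nonneg 3 R hz.1)
    (Finset.sum_nonneg fun i _ => hz.1 i) hz1 hsum (B := elemSum 2 R z) ?_ ?_
  · unfold defect at hD
    rw [gPoly_eq_othersOf hne, hz0] at hD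
    linarith
  · intro p q hp hq hpq
    set w : Fin m → ℝ := Function.update (Function.update z ⟨0, by omega⟩ p) ⟨1, by omega⟩ q
      with hw
    have hw1 : w ⟨1, by omega⟩ = q := by simp [hw]
    have hw0 : w ⟨0, by omega⟩ = p := by simp [hw]
    have hwR : ∀ i ∈ R, w i = z i := fun i hi => by
      obtain ⟨h1, h0⟩ := mem_othersOf.1 hi
      rw [hw, Function.update_of_ne h1, Function.update_of_ne h0]
    have hwnonneg : ∀ i, 0 ≤ w i := fun i => by
      by_cases h1 : i = ⟨1, by omega⟩
      · rw [h1, hw1]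
        exact hq
      by_cases h0 : i = ⟨0, by omega⟩
      · rw [h0, hw0]
        exact hp
      · rw [hwR i (mem_othersOf.2 ⟨h1, h0⟩)]
        exact hz.1 i
    have hwsum : ∑ i, w i = p + q + ∑ i ∈ R, z i := by
      rw [sum_eq_add_othersOf hne, hw0, hw1, Finset.sum_congr rfl hwR]
    have h := gPoly_add_le_of_nonneg (hm := hm) ha hwnonneg (hwsum ▸ hpq)
    rwa [gPoly_eq_othersOf hne, hwsum, hw0, hw1, elemSum_congr hwR, elemSum_congr hwR,
      Finset.sum_congr rfl hwR] at h

theorem exists_maximal_defect_zero {a : ℝ} (ha0 : 0 ≤ a) (ha : a ≤ 1) (hmu : a < muFun m hm a) :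
    ∃ z ∈ stdSimplex ℝ (Fin m), defect m hm a z = 0 ∧ 0 < z ⟨0, by omega⟩ ∧
      0 < z ⟨1, by omega⟩ ∧ ∀ w ∈ stdSimplex ℝ (Fin m), defect m hm a w = 0 →
        w ⟨1, by omega⟩ ≤ z ⟨1, by omega⟩ := by
  obtain ⟨y, hy, hyD, hy1⟩ := exists_defect_eq_zero ha0 ha (ha0.trans_lt hmu)
  have hcompact : IsCompact (stdSimplex ℝ (Fin m) ∩ {z | defect m hm a z = 0}) :=
    (isCompact_stdSimplex ℝ (Fin m)).inter_right
      (isClosed_eq (continuous_defect a) continuous_const)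
  obtain ⟨z, hz, hmax⟩ := hcompact.exists_isMaxOn ⟨y, hy, hyD⟩
    (f := fun z => z ⟨1, by omega⟩) (by fun_prop)
  have hz1 : 0 < z ⟨1, by omega⟩ := hy1.trans_le (hmax ⟨hy, hyD⟩)
  exact ⟨z, hz.1, hz.2, first_pos_of_defect_eq_zero ha0 ha hmu hz.1 hz.2 hz1, hz1,
    fun w hw hwD => hmax ⟨hw, hwD⟩⟩

/-- If `c` exceeds `z₂³` at every zero of the defect, then `ψ_{a+e}(μ(a))` grows at most
linearly with slope `c` for small `e`. -/
theorem exists_psi_muFun_le {a c : ℝ} (ha : a ≤ 1) (hc0 : 0 ≤ c)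
    (hc : ∀ w ∈ stdSimplex ℝ (Fin m), defect m hm a w = 0 → w ⟨1, by omega⟩ ^ 3 < c) :
    ∃ d > 0, ∀ e, 0 ≤ e → e ≤ d → psi m hm (a + e) (muFun m hm a) ≤ muFun m hm a + c * e := by
  have hcompact : IsCompact (stdSimplex ℝ (Fin m) ∩ {z | c ≤ z ⟨1, by omega⟩ ^ 3}) :=
    (isCompact_stdSimplex ℝ (Fin m)).inter_right (isClosed_le continuous_const (by fun_prop))
  obtain ⟨d, hd, hdD⟩ := hcompact.exists_forall_le' (f := defect m hm a)
    (continuous_defect a).continuousOn (a := 0) fun z hz =>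
      (defect_nonneg ha hz.1).lt_of_ne fun h => (hc z hz.1 h.symm).not_ge hz.2
  refine ⟨d, hd, fun e he hed => psi_le fun z hz => ?_⟩
  have hkey : e * z ⟨1, by omega⟩ ^ 3 ≤ defect m hm a z + c * e := by
    rcases le_or_gt c (z ⟨1, by omega⟩ ^ 3) with h | h
    · have h1 := hdD z ⟨hz, h⟩
      have h2 := mul_le_of_le_one_right he (pow_three_le_one hz ⟨1, by omega⟩)
      linarith [mul_nonneg hc0 he]
    · linarith [defect_nonneg (hm := hm) ha hz, mul_le_mul_of_nonneg_left h.le he]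
  unfold defect at hkey
  linarith

end Maximizers

/-- Properties of the full-tail values `ν_j := Λ(β_j, β_{j+1}, …)` for a sequence
`β_j = α + ε_j` with `ε_j > 0` strictly decreasing to `0` and `ε_j/ε_{j+1} → 1`:
(i) `ν_j = ψ_{β_j}(ν_{j+1})`; (ii) `ν_j → μ`; (iii) `ψ_{β_j}(μ) ≤ ν_{j+1}` for
all sufficiently large `j`. -/
theorem full_tail_values (m : ℕ) (hm : 3 ≤ m) (hm4 : 4 ≤ m) (α : ℝ)
    (hα : α ∈ Set.Ico (0 : ℝ) 1)
    (hgap : α < ((m : ℝ) - 2) * ((m : ℝ) - 3) / ((m : ℝ) - 1) ^ 2)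
    (β ε : ℕ → ℝ)
    (hβε : ∀ j, β j = α + ε j)
    (hβ1 : ∀ j, β j ≤ 1)
    (hεpos : ∀ j, 0 < ε j)
    (hεanti : StrictAnti ε)
    (hε0 : Filter.Tendsto ε Filter.atTop (nhds 0))
    (hεratio : Filter.Tendsto (fun j => ε j / ε (j + 1)) Filter.atTop (nhds 1))
    (ν : ℕ → ℝ)
    (hν : ∀ j, Filter.Tendsto (fun s => LambdaTrunc m hm s (fun i => β (j + i)))
      Filter.atTop (nhds (ν j))) :
    (∀ j, ν j = psi m hm (β j) (ν (j + 1))) ∧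
    Filter.Tendsto ν Filter.atTop (nhds (muFun m hm α)) ∧
    (∀ᶠ j in Filter.atTop, psi m hm (β j) (muFun m hm α) ≤ ν (j + 1)) := by
  obtain ⟨hα0, hα1⟩ := hα
  have hβ0 : ∀ j, 0 ≤ β j := fun j => by rw [hβε]; linarith [hεpos j]
  have hrec : ∀ j, ν j = psi m hm (β j) (ν (j + 1)) := by
    intro j
    refine tendsto_nhds_unique ((tendsto_add_atTop_iff_nat 1).2 (hν j)) ?_
    have h := ((lipschitzWith_psi (hm := hm) (β j)).continuous.tendsto _).comp (hν (j + 1))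
    refine h.congr fun s => ?_
    simp only [Function.comp_apply, LambdaTrunc, Nat.add_zero]
    congr 2
    funext i
    congr 1
    ring
  have hν0 : ∀ j, 0 ≤ ν j := fun j =>
    ge_of_tendsto' (hν j) fun s => LambdaTrunc_nonneg s fun i => hβ0 (j + i)
  have hbdd : BddBelow (Set.range ν) := ⟨0, by rintro _ ⟨j, rfl⟩; exact hν0 j⟩
  have hlower : ∀ j, muFun m hm α ≤ ν j := by
    have hinf : psi m hm α (⨅ j, ν j) ≤ ⨅ j, ν j := by
      refine le_ciInf fun j => ?_
      rw [hrec j]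
      exact psi_mono (by rw [hβε]; linarith [hεpos j]) (ciInf_le hbdd (j + 1))
    exact fun j => (muFun_le_of_psi_le hinf).trans (ciInf_le hbdd j)
  have hmu : α < muFun m hm α := hgap.trans_le (le_muFun hm4 hα0 hα1.le)
  have hupper : ∀ j, ν j ≤ muFun m hm α + ε j := by
    intro j
    have hαβ : α ≤ β j := by rw [hβε]; linarith [hεpos j]
    have hβmu : 0 ≤ muFun m hm (β j) := le_trans
      (div_nonneg (mul_nonneg (by linarith [show (4 : ℝ) ≤ m by exact_mod_cast hm4])
        (by linarith [show (4 : ℝ) ≤ m by exact_mod_cast hm4])) (sq_nonneg _))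
      (le_muFun hm4 (hβ0 j) (hβ1 j))
    have h : ν j ≤ muFun m hm (β j) := le_of_tendsto' (hν j) fun s =>
      LambdaTrunc_le hβmu (psi_muFun_le (hβ1 j)) s fun i => by
        rw [hβε, hβε]
        linarith [hεanti.antitone (Nat.le_add_right j i)]
    have h' := muFun_le_add (hm := hm) hα1.le hαβ
    rw [hβε j] at h h'
    linarith
  refine ⟨hrec, ?_, ?_⟩
  · refine tendsto_of_tendsto_of_tendsto_of_le_of_le tendsto_const_nhds ?_ hlower hupper
    simpa using hε0.const_add (muFun m hm α)
  obtain ⟨z, hz, hzD, hz0, hz1, hzmax⟩ := exists_maximal_defect_zero hα0 hα1.le hmu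
  set A := z ⟨0, by omega⟩ ^ 3 with hA
  set C := z ⟨1, by omega⟩ ^ 3 with hC
  have hApos : 0 < A := pow_pos hz0 3
  have hCpos : 0 < C := pow_pos hz1 3
  have hstep : ∀ j, muFun m hm α + C * ε j + A * (ν (j + 1) - muFun m hm α) ≤ ν j := by
    intro j
    have h := le_psi (hm := hm) (β j) (ν (j + 1)) hz
    rw [← hrec, hβε] at h
    unfold defect at hzD
    linarith
  obtain ⟨d, hd, hpsi⟩ := exists_psi_muFun_le (hm := hm) (a := α) (c := C * (1 + A / 2)) hα1.le
    (by positivity) fun w hw hwD =>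
      (pow_le_pow_left₀ (hw.1 _) (hzmax w hw hwD) 3).trans_lt
        (lt_mul_of_one_lt_right hCpos (by linarith))
  have hratio : Tendsto (fun j => ε (j + 1) / ε j) atTop (nhds 1) := by
    simpa using hεratio.inv₀ one_ne_zero
  have hratio2 : Tendsto (fun j => ε (j + 1) / ε j + A * (ε (j + 2) / ε j)) atTop
      (nhds (1 + A)) := by
    have h := hratio.add (((hratio.comp (tendsto_add_atTop_nat 1)).mul hratio).const_mul A)
    rw [mul_one, mul_one] at h
    refine h.congr fun j => ?_
    have := (hεpos j).ne'
    have := (hεpos (j + 1)).ne'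
    simp only [Function.comp_apply]
    field_simp
  filter_upwards [hε0.eventually_le_const hd,
    hratio2.eventually_const_lt (show 1 + A / 2 < 1 + A by linarith)] with j hjd hj
  have h1 := hpsi (ε j) (hεpos j).le hjd
  rw [← hβε] at h1
  have h2 := hstep (j + 1)
  have h3 : C * ε (j + 2) ≤ ν (j + 2) - muFun m hm α := by
    linarith [hstep (j + 2), mul_nonneg hApos.le (sub_nonneg.2 (hlower (j + 3)))]
  have h4 : (1 + A / 2) * ε j ≤ ε (j + 1) + A * ε (j + 2) := by
    have h := mul_le_mul_of_nonneg_right hj.le (hεpos j).le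
    rwa [add_mul (ε (j + 1) / ε j), mul_assoc A, div_mul_cancel₀ _ (hεpos j).ne',
      div_mul_cancel₀ _ (hεpos j).ne'] at h
  have h5 := mul_le_mul_of_nonneg_left h3 hApos.le
  have h6 := mul_le_mul_of_nonneg_left h4 hCpos.le
  linarith
end

section
/- Let r ≥ 3 be an integer and put c_r := 9·r!/(2·r^r). If x ∈ Π^{(3)}_∞, then c_r·x ∈ Π^{(r)}_∞. Consequently, if [a,b] ⊆ Π^{(3)}_∞ then [c_r·a, c_r·b] ⊆ Π^{(r)}_∞. -/
open Filter

/-- A finite `r`-graph: a collection of `r`-element subsets (edges) of a finite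
vertex set, which we take to be `Fin n`. -/
structure HGraph (r : ℕ) where
  n : ℕ
  edges : Finset (Finset (Fin n))
  card_eq : ∀ e ∈ edges, e.card = r

/-- `H` embeds into `G` as a subgraph (via an injective map on vertices sending
edges to edges). -/
def HGraph.Embeds {r : ℕ} (H G : HGraph r) : Prop :=
  ∃ f : Fin H.n → Fin G.n, Function.Injective f ∧ ∀ e ∈ H.edges, e.image f ∈ G.edges

/-- `G` is `F`-free: no member of the family `F` embeds into `G`. -/
def IsFree {r : ℕ} (F : Set (HGraph r)) (G : HGraph r) : Prop :=
  ∀ H ∈ F, ¬ H.Embeds G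

/-- `ex(n, F)`: the maximum number of edges of an `F`-free `r`-graph on `n` vertices. -/
noncomputable def exNum (r : ℕ) (F : Set (HGraph r)) (n : ℕ) : ℕ :=
  sSup { m : ℕ | ∃ G : HGraph r, G.n = n ∧ IsFree F G ∧ G.edges.card = m }

/-- The Turán density of the family `F` is `x`. -/
def HasTuranDensity (r : ℕ) (F : Set (HGraph r)) (x : ℝ) : Prop :=
  Tendsto (fun n => (exNum r F n : ℝ) / (n.choose r : ℝ)) atTop (nhds x)

/-- `Π^{(r)}_∞`: the set of Turán densities of (possibly infinite) families of `r`-graphs. -/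
def PiInf (r : ℕ) : Set ℝ := { x | ∃ F : Set (HGraph r), HasTuranDensity r F x }

lemma HGraph.Embeds.trans {r : ℕ} {A B C : HGraph r} (hAB : A.Embeds B) (hBC : B.Embeds C) :
    A.Embeds C := by
  obtain ⟨f, hf, hfe⟩ := hAB
  obtain ⟨g, hg, hge⟩ := hBC
  refine ⟨g ∘ f, hg.comp hf, fun e he => ?_⟩
  rw [← Finset.image_image]
  exact hge _ (hfe e he)

lemma HGraph.Embeds.refl {r : ℕ} (A : HGraph r) : A.Embeds A :=
  ⟨id, Function.injective_id, fun e he => by simpa using he⟩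

lemma IsFree.of_embeds {r : ℕ} {F : Set (HGraph r)} {A B : HGraph r} (hB : IsFree F B)
    (hAB : A.Embeds B) : IsFree F A :=
  fun H hH hHA => hB H hH (hHA.trans hAB)

lemma bddAbove_freeEdgeCounts (r : ℕ) (F : Set (HGraph r)) (n : ℕ) :
    BddAbove { m : ℕ | ∃ G : HGraph r, G.n = n ∧ IsFree F G ∧ G.edges.card = m } := by
  refine ⟨2 ^ n, ?_⟩
  rintro m ⟨G, rfl, -, rfl⟩
  simpa using Finset.card_le_univ G.edges

lemma IsFree.card_edges_le_exNum {r : ℕ} {F : Set (HGraph r)} {G : HGraph r} (hG : IsFree F G) :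
    G.edges.card ≤ exNum r F G.n :=
  le_csSup (bddAbove_freeEdgeCounts r F G.n) ⟨G, rfl, hG, rfl⟩

lemma exists_isFree_of_exNum_ne_zero {r : ℕ} {F : Set (HGraph r)} {n : ℕ}
    (h : exNum r F n ≠ 0) :
    ∃ G : HGraph r, G.n = n ∧ IsFree F G ∧ G.edges.card = exNum r F n := by
  refine Nat.sSup_mem ?_ (bddAbove_freeEdgeCounts r F n)
  by_contra hne
  exact h (by rw [exNum, Set.not_nonempty_iff_eq_empty.1 hne]; simp)

/-- The edges of a free graph inside a vertex set `S` are at most `ex(|S|, F)` in number. -/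
lemma IsFree.card_edges_subset_le {r : ℕ} {F : Set (HGraph r)} {T : HGraph r} (hT : IsFree F T)
    (S : Finset (Fin T.n)) :
    (T.edges.filter (· ⊆ S)).card ≤ exNum r F S.card := by
  classical
  let g : Fin S.card ↪ Fin T.n := (S.orderEmbOfFin rfl).toEmbedding
  let G : HGraph r :=
    { n := S.card
      edges := Finset.univ.filter fun e => e.map g ∈ T.edges
      card_eq := fun e he => by
        rw [← Finset.card_map g]
        exact T.card_eq _ (Finset.mem_filter.1 he).2 }
  have hG : IsFree F G := by
    refine hT.of_embeds ⟨g, g.injective, fun e he => ?_⟩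
    rw [← Finset.map_eq_image]
    exact (Finset.mem_filter.1 he).2
  refine le_trans ?_ hG.card_edges_le_exNum
  refine le_trans (Finset.card_le_card ?_) (Finset.card_image_le (s := G.edges) (f := Finset.map g))
  intro e he
  obtain ⟨heT, heS⟩ := Finset.mem_filter.1 he
  have hS : S = Finset.univ.map g := by
    ext x
    have := Finset.range_orderEmbOfFin S rfl
    have h2 := congrArg (x ∈ ·) this
    simp only [Set.mem_range, Finset.mem_coe] at h2
    simp only [Finset.mem_map, Finset.mem_univ, true_and]
    exact (iff_of_eq h2).symm
  rw [hS] at heS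
  obtain ⟨u, -, rfl⟩ := Finset.subset_map_iff.1 heS
  exact Finset.mem_image.2 ⟨u, Finset.mem_filter.2 ⟨Finset.mem_univ _, heT⟩, rfl⟩

/-- `H` arises from some `F`-free `3`-graph `T` by adding `s` new vertex classes: every edge of `H`
is an edge of `T` together with one vertex from each of the new classes. -/
def LiftsFrom (s : ℕ) (F : Set (HGraph 3)) (H : HGraph (s + 3)) : Prop :=
  ∃ T : HGraph 3, IsFree F T ∧ ∃ φ : Fin H.n → Fin T.n ⊕ Fin s,
    (∀ x y a, φ x = Sum.inl a → φ y = Sum.inl a → x = y) ∧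
    ∀ e ∈ H.edges, ∃ A ∈ T.edges, e.image φ = A.disjSum Finset.univ

/-- The family of all `(s + 3)`-graphs that do not arise from an `F`-free `3`-graph. -/
def liftFamily (s : ℕ) (F : Set (HGraph 3)) : Set (HGraph (s + 3)) :=
  { H | ¬ LiftsFrom s F H }

lemma isFree_liftFamily_iff {s : ℕ} {F : Set (HGraph 3)} {G : HGraph (s + 3)} :
    IsFree (liftFamily s F) G ↔ LiftsFrom s F G := by
  constructor
  · intro h
    by_contra hG
    exact h G hG (HGraph.Embeds.refl G)
  · rintro ⟨T, hT, φ, hφ, hφe⟩ H hH ⟨f, hf, hfe⟩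
    refine hH ⟨T, hT, φ ∘ f, fun x y a hx hy => hf (hφ _ _ a hx hy), fun e he => ?_⟩
    rw [← Finset.image_image]
    exact hφe _ (hfe e he)

lemma LiftsFrom.exists_card_edges_le {s : ℕ} {F : Set (HGraph 3)} {H : HGraph (s + 3)}
    (hH : LiftsFrom s F H) :
    ∃ (m : ℕ) (w : Fin s → ℕ), m + ∑ i, w i ≤ H.n ∧ H.edges.card ≤ exNum 3 F m * ∏ i, w i := by
  classical
  obtain ⟨T, hT, φ, hφ, hφe⟩ := hH
  let S : Finset (Fin T.n) := Finset.univ.filter fun a => ∃ x, φ x = Sum.inl a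
  let W : Fin s → Finset (Fin H.n) := fun i => Finset.univ.filter fun x => φ x = Sum.inr i
  refine ⟨S.card, fun i => (W i).card, ?_, ?_⟩
  · have hn : H.n = ∑ b : Fin T.n ⊕ Fin s, (Finset.univ.filter fun x => φ x = b).card := by
      rw [← Finset.card_eq_sum_card_fiberwise (fun x _ => Finset.mem_univ (φ x)), Finset.card_fin]
    refine le_trans ?_ hn.ge
    rw [Fintype.sum_sum_type]
    refine Nat.add_le_add_right ?_ _
    rw [Finset.card_filter]
    refine Finset.sum_le_sum fun a _ => ?_
    split_ifs with h
    · obtain ⟨x, hx⟩ := h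
      exact Finset.card_pos.2 ⟨x, by simpa using hx⟩
    · exact Nat.zero_le _
  · let build : Finset (Fin T.n) × (Fin s → Fin H.n) → Finset (Fin H.n) := fun p =>
      (Finset.univ.filter fun x => ∃ a ∈ p.1, φ x = Sum.inl a) ∪ Finset.univ.image p.2
    have hsub : H.edges ⊆
        ((T.edges.filter (· ⊆ S)) ×ˢ Fintype.piFinset W).image build := by
      intro e he
      obtain ⟨A, hA, hAe⟩ := hφe e he
      have hinj : Set.InjOn φ e := by
        rw [← Finset.card_image_iff, hAe, H.card_eq e he, Finset.card_disjSum, T.card_eq A hA]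
        simp [add_comm]
      have hleft : ∀ a ∈ A, ∃ x ∈ e, φ x = Sum.inl a := fun a ha =>
        Finset.mem_image.1 (hAe ▸ Finset.inl_mem_disjSum.2 ha)
      have hright : ∀ i, ∃ x ∈ e, φ x = Sum.inr i := fun i =>
        Finset.mem_image.1 (hAe ▸ Finset.inr_mem_disjSum.2 (Finset.mem_univ i))
      choose g hge hg using hright
      refine Finset.mem_image.2 ⟨(A, g), Finset.mem_product.2
        ⟨Finset.mem_filter.2 ⟨hA, fun a ha => ?_⟩, Fintype.mem_piFinset.2 fun i => ?_⟩, ?_⟩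
      · obtain ⟨x, -, hx⟩ := hleft a ha
        exact Finset.mem_filter.2 ⟨Finset.mem_univ _, x, hx⟩
      · exact Finset.mem_filter.2 ⟨Finset.mem_univ _, hg i⟩
      · ext x
        simp only [build, Finset.mem_union, Finset.mem_filter, Finset.mem_univ, true_and,
          Finset.mem_image]
        constructor
        · rintro (⟨a, ha, hx⟩ | ⟨i, rfl⟩)
          · obtain ⟨y, hy, hya⟩ := hleft a ha
            exact hφ x y a hx hya ▸ hy
          · exact hge i
        · intro hx
          have hmem : φ x ∈ A.disjSum Finset.univ := hAe ▸ Finset.mem_image_of_mem φ hx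
          rcases hφx : φ x with a | i
          · rw [hφx, Finset.inl_mem_disjSum] at hmem
            exact Or.inl ⟨a, hmem, rfl⟩
          · exact Or.inr ⟨i, hinj (hge i) hx ((hg i).trans hφx.symm)⟩
    calc H.edges.card ≤ _ := Finset.card_le_card hsub
      _ ≤ _ := Finset.card_image_le
      _ = (T.edges.filter (· ⊆ S)).card * ∏ i, (W i).card := by
        rw [Finset.card_product, Fintype.card_piFinset]
      _ ≤ _ := Nat.mul_le_mul_right _ (hT.card_edges_subset_le S)

lemma exNum_mul_pow_le_exNum_liftFamily (s : ℕ) (F : Set (HGraph 3)) (m q : ℕ) :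
    exNum 3 F m * q ^ s ≤ exNum (s + 3) (liftFamily s F) (m + s * q) := by
  classical
  by_cases h0 : exNum 3 F m = 0
  · simp [h0]
  obtain ⟨T, rfl, hT, hTc⟩ := exists_isFree_of_exNum_ne_zero h0
  let ψ : Fin (T.n + s * q) ≃ Fin T.n ⊕ (Fin s × Fin q) :=
    finSumFinEquiv.symm.trans (Equiv.sumCongr (Equiv.refl _) finProdFinEquiv.symm)
  let build : Finset (Fin T.n) × (Fin s → Fin q) → Finset (Fin (T.n + s * q)) := fun p =>
    (p.1.disjSum (Finset.univ.image fun i => (i, p.2 i))).map ψ.symm.toEmbedding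
  have hbuild : Function.Injective build := by
    rintro ⟨A, g⟩ ⟨B, h⟩ hAB
    have hAB' := Finset.map_injective _ hAB
    have hA : A = B := by
      ext a
      have := congrArg (Sum.inl a ∈ ·) hAB'
      simpa using this
    have hg : g = h := by
      ext i
      have := congrArg (Sum.inr (i, g i) ∈ ·) hAB'
      simp at this
      rw [this]
    rw [hA, hg]
  let H : HGraph (s + 3) :=
    { n := T.n + s * q
      edges := (T.edges ×ˢ Finset.univ).image build
      card_eq := by
        intro e he
        obtain ⟨⟨A, g⟩, hp, rfl⟩ := Finset.mem_image.1 he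
        have hA := T.card_eq A (Finset.mem_product.1 hp).1
        have hinj : Function.Injective fun i => (i, g i) := fun i j hij => congrArg Prod.fst hij
        simp only [build, Finset.card_map, Finset.card_disjSum, hA,
          Finset.card_image_of_injective _ hinj, Finset.card_fin]
        omega }
  have hH : LiftsFrom s F H := by
    refine ⟨T, hT, fun x => Sum.map id Prod.fst (ψ x), ?_, ?_⟩
    · intro x y a hx hy
      apply ψ.injective
      rcases hx' : ψ x with b | b <;> rcases hy' : ψ y with c | c <;> simp_all
    · intro e he
      obtain ⟨⟨A, g⟩, hp, rfl⟩ := Finset.mem_image.1 he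
      refine ⟨A, (Finset.mem_product.1 hp).1, ?_⟩
      simp only [build, Finset.map_eq_image, Finset.image_image]
      ext (a | i) <;> simp
  have hcard : H.edges.card = exNum 3 F T.n * q ^ s := by
    simp only [H, Finset.card_image_of_injective _ hbuild, Finset.card_product, hTc]
    simp
  rw [← hcard]
  exact (isFree_liftFamily_iff.2 hH).card_edges_le_exNum

lemma exNum_liftFamily_le {s : ℕ} {F : Set (HGraph 3)} {n : ℕ} {B : ℝ} (hB : 0 ≤ B)
    (h : ∀ (m : ℕ) (w : Fin s → ℕ), m + ∑ i, w i ≤ n → (exNum 3 F m : ℝ) * ∏ i, (w i : ℝ) ≤ B) :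
    (exNum (s + 3) (liftFamily s F) n : ℝ) ≤ B := by
  by_cases h0 : exNum (s + 3) (liftFamily s F) n = 0
  · simpa [h0] using hB
  obtain ⟨G, rfl, hG, hGc⟩ := exists_isFree_of_exNum_ne_zero h0
  obtain ⟨m, w, hmw, hle⟩ := (isFree_liftFamily_iff.1 hG).exists_card_edges_le
  rw [← hGc]
  calc (G.edges.card : ℝ) ≤ (exNum 3 F m * ∏ i, w i : ℕ) := by exact_mod_cast hle
    _ = (exNum 3 F m : ℝ) * ∏ i, (w i : ℝ) := by push_cast; rfl
    _ ≤ B := h m w hmw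

lemma pow_three_mul_prod_le {s : ℕ} {a n : ℝ} {w : Fin s → ℝ} (ha : 0 ≤ a) (hw : ∀ i, 0 ≤ w i)
    (h : a + ∑ i, w i ≤ n) :
    a ^ 3 * ∏ i, w i ≤ 27 * (n / (s + 3 : ℕ)) ^ (s + 3) := by
  let z : Fin 3 ⊕ Fin s → ℝ := Sum.elim (fun _ => a / 3) w
  have hz : ∀ i, 0 ≤ z i := by
    rintro (i | i)
    · exact div_nonneg ha (by norm_num)
    · exact hw i
  have hpos : (0 : ℝ) < (s + 3 : ℕ) := by positivity
  have hamgm := Real.geom_mean_le_arith_mean Finset.univ (fun _ => 1) z (fun _ _ => zero_le_one)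
    (by simp; positivity) (fun i _ => hz i)
  have hsum : ∑ i, z i = a + ∑ i, w i := by
    simp [z, Fintype.sum_sum_type]; ring
  have hprod : ∏ i, z i = (a / 3) ^ 3 * ∏ i, w i := by
    simp only [z, Fintype.prod_sum_type, Sum.elim_inl, Sum.elim_inr, Finset.prod_const,
      Finset.card_fin]
  have hcard : ∑ _i : Fin 3 ⊕ Fin s, (1 : ℝ) = (s + 3 : ℕ) := by
    simp [add_comm]
  simp only [Real.rpow_one, one_mul, hcard, hsum, hprod] at hamgm
  have hnn : 0 ≤ (a / 3) ^ 3 * ∏ i, w i := hprod ▸ Finset.prod_nonneg fun i _ => hz i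
  have key : (a / 3) ^ 3 * ∏ i, w i ≤ (n / (s + 3 : ℕ)) ^ (s + 3) := by
    calc (a / 3) ^ 3 * ∏ i, w i
        = (((a / 3) ^ 3 * ∏ i, w i) ^ ((s + 3 : ℕ) : ℝ)⁻¹) ^ (s + 3) :=
          (Real.rpow_inv_natCast_pow hnn (by omega)).symm
      _ ≤ (n / (s + 3 : ℕ)) ^ (s + 3) := by
          refine pow_le_pow_left₀ (Real.rpow_nonneg hnn _) (hamgm.trans ?_) _
          gcongr
  calc a ^ 3 * ∏ i, w i = 27 * ((a / 3) ^ 3 * ∏ i, w i) := by ring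
    _ ≤ _ := by gcongr

lemma tendsto_choose_div_pow (k : ℕ) :
    Tendsto (fun n : ℕ => (n.choose k : ℝ) / (n : ℝ) ^ k) atTop (nhds (1 / (k.factorial : ℝ))) := by
  have h := (isEquivalent_choose k).div
    (Asymptotics.IsEquivalent.refl (u := fun n : ℕ => (n : ℝ) ^ k) (l := atTop))
  refine (h.symm.tendsto_nhds ?_)
  refine tendsto_const_nhds.congr' ?_
  filter_upwards [eventually_gt_atTop 0] with n hn
  have : (n : ℝ) ≠ 0 := by positivity
  simp only [Pi.div_apply]
  field_simp

/-- For fixed `b > π(F)`, the Turán numbers are at most `b n³ / 6` up to a constant. -/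
lemma HasTuranDensity.exists_exNum_le {F : Set (HGraph 3)} {x b : ℝ} (hx : HasTuranDensity 3 F x)
    (hb0 : 0 ≤ b) (hb : x < b) :
    ∃ C : ℝ, 0 ≤ C ∧ ∀ m, (exNum 3 F m : ℝ) ≤ b / 6 * (m : ℝ) ^ 3 + C := by
  obtain ⟨M, hM⟩ := eventually_atTop.1 ((hx.eventually_lt_const hb).and (eventually_ge_atTop 3))
  refine ⟨∑ i ∈ Finset.range M, (exNum 3 F i : ℝ), by positivity, fun m => ?_⟩
  have hC : (0 : ℝ) ≤ ∑ i ∈ Finset.range M, (exNum 3 F i : ℝ) := by positivity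
  rcases lt_or_ge m M with hm | hm
  · have h1 : (exNum 3 F m : ℝ) ≤ ∑ i ∈ Finset.range M, (exNum 3 F i : ℝ) :=
      Finset.single_le_sum (f := fun i => (exNum 3 F i : ℝ)) (fun i _ => by positivity)
        (Finset.mem_range.2 hm)
    have : 0 ≤ b / 6 * (m : ℝ) ^ 3 := by positivity
    linarith
  · obtain ⟨h1, h3⟩ := hM m hm
    have hch : (0 : ℝ) < m.choose 3 := by exact_mod_cast Nat.choose_pos h3
    rw [div_lt_iff₀ hch] at h1
    have h2 : (m.choose 3 : ℝ) ≤ (m : ℝ) ^ 3 / 6 := by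
      simpa [Nat.factorial] using Nat.choose_le_pow_div (α := ℝ) 3 m
    nlinarith [mul_le_mul_of_nonneg_left h2 hb0]

lemma HasTuranDensity.nonneg {r : ℕ} {F : Set (HGraph r)} {x : ℝ} (hx : HasTuranDensity r F x) :
    0 ≤ x :=
  ge_of_tendsto' hx fun _ => by positivity

lemma exNum_liftFamily_le_of_exNum_le {s : ℕ} {F : Set (HGraph 3)} {b C : ℝ} (hb : 0 ≤ b)
    (hC : 0 ≤ C) (h : ∀ m, (exNum 3 F m : ℝ) ≤ b / 6 * (m : ℝ) ^ 3 + C) (n : ℕ) :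
    (exNum (s + 3) (liftFamily s F) n : ℝ) ≤
      b / 6 * (27 * ((n : ℝ) / (s + 3 : ℕ)) ^ (s + 3)) + C * (n : ℝ) ^ s := by
  refine exNum_liftFamily_le (by positivity) fun m w hmw => ?_
  have hsum : (m : ℝ) + ∑ i, (w i : ℝ) ≤ n := by exact_mod_cast hmw
  have h1 := pow_three_mul_prod_le (Nat.cast_nonneg m) (fun i => Nat.cast_nonneg (w i)) hsum
  have h2 : ∏ i, (w i : ℝ) ≤ (n : ℝ) ^ s := by
    refine (Finset.prod_le_prod (g := fun _ => (n : ℝ)) (fun i _ => Nat.cast_nonneg _)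
      fun i _ => ?_).trans (by simp)
    have := Finset.single_le_sum (f := w) (fun i _ => Nat.zero_le _) (Finset.mem_univ i)
    exact_mod_cast (by omega : w i ≤ n)
  have h3 : (0 : ℝ) ≤ ∏ i, (w i : ℝ) := by positivity
  calc (exNum 3 F m : ℝ) * ∏ i, (w i : ℝ)
      ≤ (b / 6 * (m : ℝ) ^ 3 + C) * ∏ i, (w i : ℝ) := by gcongr; exact h m
    _ = b / 6 * ((m : ℝ) ^ 3 * ∏ i, (w i : ℝ)) + C * ∏ i, (w i : ℝ) := by ring
    _ ≤ _ := by gcongr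

lemma tendsto_pow_div_choose (k : ℕ) :
    Tendsto (fun n : ℕ => (n : ℝ) ^ k / (n.choose k : ℝ)) atTop (nhds (k.factorial : ℝ)) := by
  simpa using (tendsto_choose_div_pow k).inv₀ (by positivity)

lemma tendsto_natDiv_div (r : ℕ) :
    Tendsto (fun n : ℕ => ((n / r : ℕ) : ℝ) / (n : ℝ)) atTop (nhds (1 / (r : ℝ))) := by
  have h := (tendsto_nat_floor_mul_div_atTop (R := ℝ) (a := 1 / (r : ℝ)) (by positivity)).comp
    tendsto_natCast_atTop_atTop
  refine h.congr fun n => ?_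
  simp only [Function.comp_apply]
  rw [one_div_mul_eq_div, Nat.floor_div_eq_div]

lemma tendsto_lower_bound {s : ℕ} {F : Set (HGraph 3)} {x : ℝ} (hx : HasTuranDensity 3 F x) :
    Tendsto (fun n : ℕ => (exNum 3 F (n - s * (n / (s + 3))) * ((n / (s + 3) : ℕ) : ℝ) ^ s) /
      (n.choose (s + 3) : ℝ)) atTop
      (nhds ((9 * ((s + 3).factorial : ℝ) / (2 * ((s + 3 : ℕ) : ℝ) ^ (s + 3))) * x)) := by
  have hle : ∀ n, s * (n / (s + 3)) + n / (s + 3) ≤ n := fun n => by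
    have := Nat.div_mul_le_self n (s + 3)
    nlinarith
  have hm : Tendsto (fun n : ℕ => n - s * (n / (s + 3))) atTop atTop :=
    tendsto_atTop_mono (fun n => by have := hle n; omega)
      (Nat.tendsto_div_const_atTop (show s + 3 ≠ 0 by omega))
  have hq := tendsto_natDiv_div (s + 3)
  have hmn : Tendsto (fun n : ℕ => ((n - s * (n / (s + 3)) : ℕ) : ℝ) / n) atTop
      (nhds (3 / ((s + 3 : ℕ) : ℝ))) := by
    have h : Tendsto (fun n : ℕ => 1 - (s : ℝ) * (((n / (s + 3) : ℕ) : ℝ) / n)) atTop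
        (nhds (1 - (s : ℝ) * (1 / ((s + 3 : ℕ) : ℝ)))) :=
      tendsto_const_nhds.sub (tendsto_const_nhds.mul hq)
    have e : 1 - (s : ℝ) * (1 / ((s + 3 : ℕ) : ℝ)) = 3 / ((s + 3 : ℕ) : ℝ) := by
      have : (s : ℝ) + 3 ≠ 0 := by positivity
      push_cast
      field_simp
      ring
    rw [e] at h
    refine h.congr' ?_
    filter_upwards [eventually_gt_atTop 0] with n hn
    have : (n : ℝ) ≠ 0 := by positivity
    rw [Nat.cast_sub ((Nat.le_add_right _ _).trans (hle n))]
    push_cast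
    field_simp
  have hlim := ((((hx.comp hm).mul ((tendsto_choose_div_pow 3).comp hm)).mul (hmn.pow 3)).mul
    (hq.pow s)).mul (tendsto_pow_div_choose (s + 3))
  have e : x * (1 / ((3).factorial : ℝ)) * (3 / ((s + 3 : ℕ) : ℝ)) ^ 3 *
      (1 / ((s + 3 : ℕ) : ℝ)) ^ s * ((s + 3).factorial : ℝ) =
      (9 * ((s + 3).factorial : ℝ) / (2 * ((s + 3 : ℕ) : ℝ) ^ (s + 3))) * x := by
    have : ((s + 3 : ℕ) : ℝ) ≠ 0 := by positivity
    have h6 : ((3).factorial : ℝ) = 6 := by norm_num [Nat.factorial]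
    rw [h6, pow_add]
    generalize ((s + 3 : ℕ) : ℝ) = t at *
    simp only [div_pow, one_pow]
    field_simp
    ring
  rw [e] at hlim
  refine hlim.congr' ?_
  filter_upwards [eventually_gt_atTop 0, hm.eventually_ge_atTop 3] with n hn hm3
  have hn0 : (n : ℝ) ≠ 0 := by positivity
  simp only [Function.comp_apply]
  generalize n - s * (n / (s + 3)) = m at *
  have hm0 : (m : ℝ) ≠ 0 := by positivity
  have hc : ((m.choose 3 : ℕ) : ℝ) ≠ 0 := by exact_mod_cast (Nat.choose_pos hm3).ne'
  generalize ((n / (s + 3) : ℕ) : ℝ) = q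
  simp only [div_pow, pow_add]
  field_simp

lemma tendsto_upper_bound (s : ℕ) (b C : ℝ) :
    Tendsto (fun n : ℕ => (b / 6 * (27 * ((n : ℝ) / (s + 3 : ℕ)) ^ (s + 3)) + C * (n : ℝ) ^ s) /
      (n.choose (s + 3) : ℝ)) atTop
      (nhds ((9 * ((s + 3).factorial : ℝ) / (2 * ((s + 3 : ℕ) : ℝ) ^ (s + 3))) * b)) := by
  have h0 : Tendsto (fun n : ℕ => C * ((n : ℝ)⁻¹) ^ 3) atTop (nhds (C * 0 ^ 3)) :=
    (tendsto_inv_atTop_nhds_zero_nat.pow 3).const_mul C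
  have hlim := (h0.const_add (b / 6 * (27 / ((s + 3 : ℕ) : ℝ) ^ (s + 3)))).mul
    (tendsto_pow_div_choose (s + 3))
  have e : (b / 6 * (27 / ((s + 3 : ℕ) : ℝ) ^ (s + 3)) + C * 0 ^ 3) * ((s + 3).factorial : ℝ) =
      (9 * ((s + 3).factorial : ℝ) / (2 * ((s + 3 : ℕ) : ℝ) ^ (s + 3))) * b := by
    field_simp
    ring
  rw [e] at hlim
  refine hlim.congr' ?_
  filter_upwards [eventually_gt_atTop 0] with n hn
  have hn0 : (n : ℝ) ≠ 0 := by positivity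
  have : C * (n : ℝ) ^ s = C * ((n : ℝ)⁻¹) ^ 3 * (n : ℝ) ^ (s + 3) := by
    rw [pow_add]
    field_simp
  rw [this, div_pow]
  ring

lemma HasTuranDensity.liftFamily {s : ℕ} {F : Set (HGraph 3)} {x : ℝ}
    (hx : HasTuranDensity 3 F x) :
    HasTuranDensity (s + 3) (liftFamily s F)
      ((9 * ((s + 3).factorial : ℝ) / (2 * ((s + 3 : ℕ) : ℝ) ^ (s + 3))) * x) := by
  set c : ℝ := 9 * ((s + 3).factorial : ℝ) / (2 * ((s + 3 : ℕ) : ℝ) ^ (s + 3)) with hc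
  have hc0 : 0 < c := by positivity
  refine tendsto_order.2 ⟨fun y hy => ?_, fun y hy => ?_⟩
  · filter_upwards [(tendsto_lower_bound (s := s) hx).eventually_const_lt hy] with n hn
    refine hn.trans_le ?_
    have hsub : n - s * (n / (s + 3)) + s * (n / (s + 3)) = n := by
      refine Nat.sub_add_cancel ?_
      have := Nat.div_mul_le_self n (s + 3)
      nlinarith
    have h := exNum_mul_pow_le_exNum_liftFamily s F (n - s * (n / (s + 3))) (n / (s + 3))
    rw [hsub] at h
    gcongr
    exact_mod_cast h
  · obtain ⟨b, hxb, hby⟩ := exists_between ((lt_div_iff₀' hc0).2 hy)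
    have hb0 : 0 ≤ b := hx.nonneg.trans hxb.le
    obtain ⟨C, hC, hle⟩ := hx.exists_exNum_le hb0 hxb
    filter_upwards [(tendsto_upper_bound s b C).eventually_lt_const
      ((lt_div_iff₀' hc0).1 hby)] with n hn
    refine lt_of_le_of_lt ?_ hn
    gcongr
    exact exNum_liftFamily_le_of_exNum_le hb0 hC hle n

/-- Lifting to higher uniformities: with `c_r := 9·r!/(2·r^r)`, if `x ∈ Π^{(3)}_∞`
then `c_r·x ∈ Π^{(r)}_∞`; consequently intervals in `Π^{(3)}_∞` lift to intervals
in `Π^{(r)}_∞`. -/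
theorem uniformity_lift (r : ℕ) (hr : 3 ≤ r) :
    (∀ x ∈ PiInf 3, (9 * (r.factorial : ℝ) / (2 * (r : ℝ) ^ r)) * x ∈ PiInf r) ∧
    (∀ a b : ℝ, Set.Icc a b ⊆ PiInf 3 →
      Set.Icc ((9 * (r.factorial : ℝ) / (2 * (r : ℝ) ^ r)) * a)
        ((9 * (r.factorial : ℝ) / (2 * (r : ℝ) ^ r)) * b) ⊆ PiInf r) := by
  have hlift : ∀ x ∈ PiInf 3, (9 * (r.factorial : ℝ) / (2 * (r : ℝ) ^ r)) * x ∈ PiInf r := by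
    obtain ⟨s, rfl⟩ := Nat.exists_eq_add_of_le' hr
    rintro x ⟨F, hF⟩
    exact ⟨liftFamily s F, hF.liftFamily⟩
  refine ⟨hlift, fun a b hab y hy => ?_⟩
  have hc : 0 < 9 * (r.factorial : ℝ) / (2 * (r : ℝ) ^ r) := by
    have : 0 < r := by omega
    positivity
  rw [← mul_div_cancel₀ y hc.ne']
  exact hlift _ (hab ⟨(le_div_iff₀' hc).2 hy.1, (div_le_iff₀' hc).2 hy.2⟩)
end
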